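/- Let 𝒳 be a separable real Hilbert space and (P_t)_{t≥0} a Feller, stochastically continuous Markov transition semigroup on 𝒳 with the e-property. Let 𝒦 ⊆ 𝒳 be compact and suppose that for every y ∈ 𝒦 there exists a bounded Borel set B_y ⊆ 𝒳 with liminf_{T→∞} Q^T(y, B_y) > 3/4. Then there exist a bounded Borel set B ⊆ 𝒳 and r* > 0 such that liminf_{T→∞} Q^T(x, B) > 1/2 for every x ∈ 𝒦 + r*B(0,1). -/

import Mathlib

open MeasureTheory Filter Topology Metric Set

noncomputable section

/-- A Markov transition semigroup on a measurable space `X`: a jointly measurable family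
of Markov probability kernels `P t x` with `P 0 x = δ_x` and the Chapman–Kolmogorov
semigroup property for nonnegative times. -/
structure MarkovSemigroup (X : Type*) [MeasurableSpace X] where
  P : ℝ → X → MeasureTheory.Measure X
  prob : ∀ t x, MeasureTheory.IsProbabilityMeasure (P t x)
  meas : Measurable fun p : ℝ × X => P p.1 p.2
  init : ∀ x : X, P 0 x = MeasureTheory.Measure.dirac x
  semigroup : ∀ t s : ℝ, 0 ≤ t → 0 ≤ s → ∀ x : X,
    P (t + s) x = (P t x).bind (P s)

namespace MarkovSemigroup

variable {X : Type*} [MeasurableSpace X]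

/-- Action `P_t f(x) = ∫ f(y) P_t(x,dy)` on functions. -/
def act (M : MarkovSemigroup X) (t : ℝ) (f : X → ℝ) (x : X) : ℝ :=
  ∫ y, f y ∂(M.P t x)

/-- Dual action `P_t^* μ` on measures. -/
def dual (M : MarkovSemigroup X) (t : ℝ) (μ : MeasureTheory.Measure X) :
    MeasureTheory.Measure X :=
  μ.bind (M.P t)

/-- The time average `Q^T μ = (1/T) ∫_0^T P_s^* μ ds` (with the convention
`Q^T μ = μ` for `T ≤ 0`). -/
def QM (M : MarkovSemigroup X) (T : ℝ) (μ : MeasureTheory.Measure X) :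
    MeasureTheory.Measure X :=
  if T ≤ 0 then μ
  else ((ENNReal.ofReal (1 / T)) • (volume.restrict (Set.Ioc (0 : ℝ) T))).bind
    fun s => M.dual s μ

/-- `Q^T(x,·) := Q^T δ_x`. -/
def Q (M : MarkovSemigroup X) (T : ℝ) (x : X) : MeasureTheory.Measure X :=
  M.QM T (MeasureTheory.Measure.dirac x)

/-- Iterated averages: for `ts = [t_k, …, t_1]`, `QMs ts μ = Q^{t_k}(⋯(Q^{t_1} μ)⋯)`. -/
def QMs (M : MarkovSemigroup X) (ts : List ℝ) (μ : MeasureTheory.Measure X) :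
    MeasureTheory.Measure X :=
  ts.foldr (fun t ν => M.QM t ν) μ

/-- A measure is invariant if `P_t^* μ = μ` for all `t ≥ 0`. -/
def Invariant (M : MarkovSemigroup X) (μ : MeasureTheory.Measure X) : Prop :=
  ∀ t : ℝ, 0 ≤ t → M.dual t μ = μ

section TopologicalDefs

variable [TopologicalSpace X]

/-- Bounded continuous real functions. -/
def IsBddContinuous (f : X → ℝ) : Prop :=
  Continuous f ∧ ∃ C : ℝ, ∀ x, |f x| ≤ C

/-- The Feller property: `P_t` maps bounded continuous functions to continuous ones. -/
def Feller (M : MarkovSemigroup X) : Prop :=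
  ∀ t : ℝ, 0 ≤ t → ∀ f : X → ℝ, MarkovSemigroup.IsBddContinuous f →
    Continuous (M.act t f)

/-- Stochastic continuity: `P_t f(x) → f(x)` as `t → 0+`. -/
def StochasticallyContinuous (M : MarkovSemigroup X) : Prop :=
  ∀ f : X → ℝ, MarkovSemigroup.IsBddContinuous f → ∀ x : X,
    Filter.Tendsto (fun t : ℝ => M.act t f x) (nhdsWithin 0 (Set.Ioi 0)) (nhds (f x))

/-- Weak convergence of `Q^T ν` to `μ` as `T → ∞`. -/
def QTendsto (M : MarkovSemigroup X) (ν μ : MeasureTheory.Measure X) : Prop :=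
  ∀ f : X → ℝ, MarkovSemigroup.IsBddContinuous f →
    Filter.Tendsto (fun T : ℝ => ∫ x, f x ∂(M.QM T ν)) Filter.atTop
      (nhds (∫ x, f x ∂μ))

/-- Weak-* mean ergodicity with limit `μstar`. -/
def WeakStarMeanErgodic (M : MarkovSemigroup X) (μstar : MeasureTheory.Measure X) : Prop :=
  ∀ ν : MeasureTheory.Measure X, MeasureTheory.IsProbabilityMeasure ν → M.QTendsto ν μstar

/-- Tightness of the family `(Q^T(x,·))_{T>0}`. -/
def TightAt (M : MarkovSemigroup X) (x : X) : Prop :=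
  ∀ ε : ℝ, 0 < ε → ∃ K : Set X, IsCompact K ∧
    ∀ T : ℝ, 0 < T → 1 - ε ≤ ((M.Q T x) K).toReal

end TopologicalDefs

end MarkovSemigroup

/-- Topological support of a measure: points all of whose open neighborhoods
have positive mass. -/
def msupport {X : Type*} [MeasurableSpace X] [TopologicalSpace X]
    (μ : MeasureTheory.Measure X) : Set X :=
  {x : X | ∀ U : Set X, IsOpen U → x ∈ U → 0 < μ U}

/-- Total variation distance between two (finite) measures, as the supremum over
Borel sets of the discrepancy of masses. -/
def tvDist {X : Type*} [MeasurableSpace X] (μ ν : MeasureTheory.Measure X) : ℝ :=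
  ⨆ B : {B : Set X // MeasurableSet B}, |(μ B.1).toReal - (ν B.1).toReal|

section MetricDefs

variable {X : Type*} [MeasurableSpace X] [PseudoMetricSpace X]

/-- Bounded Lipschitz real functions. -/
def IsBddLipschitz (ψ : X → ℝ) : Prop :=
  (∃ K : NNReal, LipschitzWith K ψ) ∧ ∃ C : ℝ, ∀ x, |ψ x| ≤ C

/-- The e-property: equicontinuity of `(P_t ψ)_{t ≥ 0}` at every point, for every
bounded Lipschitz `ψ`. -/
def MarkovSemigroup.EProperty (M : MarkovSemigroup X) : Prop :=
  ∀ ψ : X → ℝ, IsBddLipschitz ψ → ∀ x : X, ∀ ε : ℝ, 0 < ε →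
    ∃ δ : ℝ, 0 < δ ∧ ∀ z : X, dist z x < δ → ∀ t : ℝ, 0 ≤ t →
      |M.act t ψ z - M.act t ψ x| < ε

end MetricDefs

namespace MarkovSemigroup

variable {X : Type*} [MeasurableSpace X] (M : MarkovSemigroup X)

theorem measurable_P (t : ℝ) : Measurable (M.P t) :=
  M.meas.comp measurable_prodMk_left

theorem dual_dirac (t : ℝ) (x : X) : M.dual t (Measure.dirac x) = M.P t x :=
  Measure.dirac_bind (M.measurable_P t) x

/-- The time average as an explicit integral of transition probabilities. -/
theorem Q_apply {T : ℝ} (hT : 0 < T) (x : X) {A : Set X} (hA : MeasurableSet A) :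
    M.Q T x A = ENNReal.ofReal (1 / T) * ∫⁻ s in Ioc (0 : ℝ) T, M.P s x A := by
  have hm : Measurable fun s : ℝ => M.P s x := M.meas.comp measurable_prodMk_right
  simp only [Q, QM, not_le.mpr hT, if_false, dual_dirac]
  rw [Measure.bind_apply hA hm.aemeasurable, lintegral_smul_measure, smul_eq_mul]

theorem ofReal_one_div_mul_volume_Ioc {T : ℝ} (hT : 0 < T) :
    ENNReal.ofReal (1 / T) * volume (Ioc (0 : ℝ) T) = 1 := by
  rw [Real.volume_Ioc, sub_zero, ← ENNReal.ofReal_mul (by positivity),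
    one_div_mul_cancel hT.ne', ENNReal.ofReal_one]

theorem isProbabilityMeasure_Q {T : ℝ} (hT : 0 < T) (x : X) :
    IsProbabilityMeasure (M.Q T x) := by
  have := fun s => M.prob s x
  constructor
  rw [M.Q_apply hT x MeasurableSet.univ]
  simpa using ofReal_one_div_mul_volume_Ioc hT

/-- A time-uniform comparison of transition probabilities passes to the time averages. -/
theorem Q_le_Q_add {x z : X} {A B : Set X} (hA : MeasurableSet A) (hB : MeasurableSet B)
    {c : ENNReal} (h : ∀ s : ℝ, 0 ≤ s → M.P s x A ≤ M.P s z B + c) {T : ℝ} (hT : 0 < T) :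
    M.Q T x A ≤ M.Q T z B + c := by
  rw [M.Q_apply hT x hA, M.Q_apply hT z hB]
  calc ENNReal.ofReal (1 / T) * ∫⁻ s in Ioc (0 : ℝ) T, M.P s x A
      ≤ ENNReal.ofReal (1 / T) * ∫⁻ s in Ioc (0 : ℝ) T, (M.P s z B + c) := by
        gcongr 1
        exact setLIntegral_mono' measurableSet_Ioc fun s hs => h s hs.1.le
    _ = ENNReal.ofReal (1 / T) * (∫⁻ s in Ioc (0 : ℝ) T, M.P s z B) + c := by
        rw [lintegral_add_right _ measurable_const, setLIntegral_const, mul_add,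
          mul_left_comm, ofReal_one_div_mul_volume_Ioc hT, mul_one]

/-- Lower bounds on the liminf of time averages are stable under small time-uniform
perturbations of the transition probabilities. -/
theorem lt_liminf_Q_of_forall_le {x z : X} {A B : Set X} (hA : MeasurableSet A)
    (hB : MeasurableSet B) {a b c : ℝ} (hc : 0 ≤ c) (hab : b + c < a)
    (h : ∀ s : ℝ, 0 ≤ s → M.P s x A ≤ M.P s z B + ENNReal.ofReal c)
    (hx : a < liminf (fun T : ℝ => (M.Q T x A).toReal) atTop) :
    b < liminf (fun T : ℝ => (M.Q T z B).toReal) atTop := by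
  have hev : ∀ᶠ T : ℝ in atTop, a < (M.Q T x A).toReal :=
    eventually_lt_of_lt_liminf hx (isBoundedUnder_of ⟨0, fun _ => ENNReal.toReal_nonneg⟩)
  have hbdd : IsBoundedUnder (· ≤ ·) atTop fun T : ℝ => (M.Q T z B).toReal := by
    refine isBoundedUnder_of_eventually_le (a := 1) ?_
    filter_upwards [eventually_gt_atTop 0] with T hT
    have := M.isProbabilityMeasure_Q hT z
    exact measureReal_le_one
  refine lt_of_lt_of_le (by linarith : b < a - c)
    (le_liminf_of_le hbdd.isCoboundedUnder_ge ?_)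
  filter_upwards [hev, eventually_gt_atTop 0] with T hT hT0
  have := M.isProbabilityMeasure_Q hT0 z
  have hle := ENNReal.toReal_mono (by finiteness) (M.Q_le_Q_add hA hB h hT0)
  rw [ENNReal.toReal_add (by finiteness) (by finiteness), ENNReal.toReal_ofReal hc] at hle
  linarith

end MarkovSemigroup

/-- Under the e-property, the transition probabilities of a bounded set are controlled,
uniformly in time, by those of a larger bounded set started from any nearby point. -/
theorem MarkovSemigroup.EProperty.exists_P_le_P_add {X : Type*} [MeasurableSpace X]
    [PseudoMetricSpace X] [BorelSpace X] {M : MarkovSemigroup X}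
    (hE : M.EProperty) (x : X) {A : Set X} (hA : Bornology.IsBounded A)
    (hAm : MeasurableSet A) {ε : ℝ} (hε : 0 < ε) :
    ∃ B : Set X, Bornology.IsBounded B ∧ MeasurableSet B ∧ ∃ δ : ℝ, 0 < δ ∧
      ∀ z ∈ ball x δ, ∀ s : ℝ, 0 ≤ s → M.P s x A ≤ M.P s z B + ENNReal.ofReal ε := by
  let f := thickenedIndicator one_pos A
  let ψ : X → ℝ := fun y => f y
  have hψ0 (y) : 0 ≤ ψ y := (f y).coe_nonneg
  have hψ1 (y) : ψ y ≤ 1 := thickenedIndicator_le_one one_pos A y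
  have hψL : ∃ L, LipschitzWith L ψ :=
    ⟨_, fun y w => lipschitzWith_thickenedIndicator one_pos A y w⟩
  obtain ⟨δ, hδ, hd⟩ := hE ψ
    ⟨hψL, 1, fun y => abs_le.2 ⟨by linarith [hψ0 y], hψ1 y⟩⟩ x ε hε
  refine ⟨thickening 1 A, hA.thickening, isOpen_thickening.measurableSet, δ, hδ,
    fun z hz s hs => ?_⟩
  have := M.prob s
  have hint (w) : Integrable ψ (M.P s w) :=
    Integrable.of_bound hψL.choose_spec.continuous.measurable.aestronglyMeasurable 1
      (ae_of_all _ fun y => by rw [Real.norm_of_nonneg (hψ0 y)]; exact hψ1 y)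
  have hlow : (M.P s x).real A ≤ M.act s ψ x := by
    rw [← integral_indicator_one hAm]
    refine integral_mono ((integrable_const 1).indicator hAm) (hint x) fun y => ?_
    refine indicator_le' (fun y hy => ?_) (fun y _ => hψ0 y) y
    exact (congrArg NNReal.toReal (thickenedIndicator_one one_pos A hy)).ge
  have hupp : M.act s ψ z ≤ (M.P s z).real (thickening 1 A) := by
    rw [← integral_indicator_one isOpen_thickening.measurableSet]
    refine integral_mono (hint z)
      ((integrable_const 1).indicator isOpen_thickening.measurableSet) fun y => ?_
    refine le_indicator (fun y _ => hψ1 y) (fun y hy => ?_) y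
    exact (congrArg NNReal.toReal (thickenedIndicator_zero one_pos A hy)).le
  have hdist := (abs_lt.1 (hd z hz s hs)).1
  rw [← ofReal_measureReal (μ := M.P s x), ← ofReal_measureReal (μ := M.P s z),
    ← ENNReal.ofReal_add measureReal_nonneg hε.le]
  exact ENNReal.ofReal_le_ofReal (by linarith)

/-- Step I of the proof of Theorem 3. On a separable Hilbert space,
for a Feller, stochastically continuous semigroup with the e-property: if each point `y`
of a compact set `𝒦` has a bounded Borel set with ergodic averages eventually above
`3/4`, then there are a bounded Borel set `B` and `r* > 0` such that
`liminf_T Q^T(x,B) > 1/2` on the `r*`-neighborhood of `𝒦`. -/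
theorem ergodic_lower_bound_on_attractor_neighborhood
    {X : Type*} [NormedAddCommGroup X] [InnerProductSpace ℝ X] [CompleteSpace X]
    [SecondCountableTopology X] [MeasurableSpace X] [BorelSpace X]
    (M : MarkovSemigroup X)
    (hFeller : M.Feller) (hSC : M.StochasticallyContinuous) (hE : M.EProperty)
    (K : Set X) (hKcpt : IsCompact K)
    (hloc : ∀ y ∈ K, ∃ B : Set X, Bornology.IsBounded B ∧ MeasurableSet B ∧
      (3 : ℝ) / 4 < Filter.liminf (fun T : ℝ => ((M.Q T y) B).toReal) Filter.atTop) :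
    ∃ B : Set X, ∃ rstar : ℝ,
      Bornology.IsBounded B ∧ MeasurableSet B ∧ 0 < rstar ∧
      ∀ x ∈ Metric.thickening rstar K,
        (1 : ℝ) / 2 <
          Filter.liminf (fun T : ℝ => ((M.Q T x) B).toReal) Filter.atTop := by
  obtain ⟨U, B, hU, hKU, hB, hBm, hUB⟩ : ∃ U B : Set X, IsOpen U ∧ K ⊆ U ∧
      Bornology.IsBounded B ∧ MeasurableSet B ∧ ∀ x ∈ U,
        (1 : ℝ) / 2 < liminf (fun T : ℝ => ((M.Q T x) B).toReal) atTop := by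
    have enlarge {x : X} {A B : Set X} (hA : MeasurableSet A) (hB : MeasurableSet B)
        (hAB : A ⊆ B)
        (hx : (1 : ℝ) / 2 < liminf (fun T : ℝ => ((M.Q T x) A).toReal) atTop) :
        (1 : ℝ) / 2 < liminf (fun T : ℝ => ((M.Q T x) B).toReal) atTop := by
      obtain ⟨a, ha, hax⟩ := exists_between hx
      exact M.lt_liminf_Q_of_forall_le hA hB le_rfl (by simpa using ha)
        (fun s _ => (measure_mono hAB).trans le_self_add) hax
    refine hKcpt.induction_on (p := fun S => ∃ U B : Set X, IsOpen U ∧ S ⊆ U ∧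
      Bornology.IsBounded B ∧ MeasurableSet B ∧ ∀ x ∈ U,
        (1 : ℝ) / 2 < liminf (fun T : ℝ => ((M.Q T x) B).toReal) atTop) ?_ ?_ ?_ ?_
    · exact ⟨∅, ∅, isOpen_empty, Subset.rfl, Bornology.isBounded_empty, .empty, by simp⟩
    · rintro S S' hS ⟨U, B, hU, hSU, h⟩
      exact ⟨U, B, hU, hS.trans hSU, h⟩
    · rintro S S' ⟨U, B, hU, hSU, hB, hBm, h⟩ ⟨U', B', hU', hSU', hB', hBm', h'⟩
      refine ⟨U ∪ U', B ∪ B', hU.union hU', union_subset_union hSU hSU', hB.union hB',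
        hBm.union hBm', ?_⟩
      rintro x (hx | hx)
      · exact enlarge hBm (hBm.union hBm') subset_union_left (h x hx)
      · exact enlarge hBm' (hBm.union hBm') subset_union_right (h' x hx)
    · intro y hy
      obtain ⟨A, hA, hAm, hyA⟩ := hloc y hy
      obtain ⟨B, hB, hBm, δ, hδ, h⟩ :=
        hE.exists_P_le_P_add y hA hAm (by norm_num : (0 : ℝ) < 1 / 8)
      exact ⟨ball y δ, mem_nhdsWithin_of_mem_nhds (ball_mem_nhds y hδ), ball y δ, B,
        isOpen_ball, Subset.rfl, hB, hBm, fun x hx =>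
          M.lt_liminf_Q_of_forall_le hAm hBm (by norm_num) (by norm_num) (h x hx) hyA⟩
  obtain ⟨r, hr, hrU⟩ := hKcpt.exists_thickening_subset_open hU hKU
  exact ⟨B, r, hB, hBm, hr, fun x hx => hUB x (hrU hx)⟩
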